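/- Let T = Cat(d₁, d₂, …, d_ℓ) be a caterpillar tree satisfying σ(T) ≥ 5, ℓ ≥ σ(T) + 3 and σ(T) ≥ Δ(T) + 2, where Δ(T) is the maximum degree of T. Then T is κ-two-sided strong edge-pre-colorable for every integer κ ≥ σ(T). -/

import Mathlib

open SimpleGraph

/-- The degree of a vertex (cardinality of its neighbor set). -/
noncomputable def ndeg {V : Type*} (G : SimpleGraph V) (v : V) : ℕ :=
  (G.neighborSet v).ncard

/-- `σ(G)`: the maximum of `deg x + deg y - 1` over all edges `xy` of `G`. -/
noncomputable def sigmaG {V : Type*} (G : SimpleGraph V) : ℕ :=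
  sSup {m | ∃ x y, G.Adj x y ∧ m = ndeg G x + ndeg G y - 1}

/-- The maximum degree `Δ(G)`. -/
noncomputable def maxDeg {V : Type*} (G : SimpleGraph V) : ℕ :=
  sSup (Set.range (ndeg G))

/-- Two edges are at distance at most two: they share an endpoint, or an endpoint of
one is adjacent to an endpoint of the other. -/
def EdgesNear {V : Type*} (G : SimpleGraph V) (e f : Sym2 V) : Prop :=
  ∃ u v, u ∈ e ∧ v ∈ f ∧ (u = v ∨ G.Adj u v)

/-- A strong edge-coloring: every two distinct edges at distance at most two
receive different colors. -/
def IsStrongEdgeColoring {V α : Type*} (G : SimpleGraph V) (φ : Sym2 V → α) : Prop :=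
  ∀ e ∈ G.edgeSet, ∀ f ∈ G.edgeSet, e ≠ f → EdgesNear G e f → φ e ≠ φ f

/-- The strong chromatic index `χ'ₛ(G)`: the least `k` such that `G` has a strong
edge-coloring with colors `0, …, k-1`. -/
noncomputable def strongChromaticIndex {V : Type*} (G : SimpleGraph V) : ℕ :=
  sInf {k | ∃ φ : Sym2 V → ℕ, (∀ e ∈ G.edgeSet, φ e < k) ∧ IsStrongEdgeColoring G φ}

/-- The set of edges incident with a vertex `v`. -/
def Einc {V : Type*} (G : SimpleGraph V) (v : V) : Set (Sym2 V) :=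
  {e ∈ G.edgeSet | v ∈ e}
/-- The vertex type of the caterpillar tree `Cat(d 1, …, d ℓ)`: the spine
`x_0, x_1, …, x_{ℓ+1}` (as `Fin (ℓ+2)`) together with `d (i+1) - 2` pendant leaves
attached to the spine vertex `x_{i+1}` for each `i : Fin ℓ`. -/
abbrev CatV (ℓ : ℕ) (d : ℕ → ℕ) : Type :=
  Fin (ℓ + 2) ⊕ (Σ i : Fin ℓ, Fin (d (i.val + 1) - 2))

/-- Generating relation for the caterpillar: consecutive spine vertices are adjacent,
and each leaf in the `i`-th leaf group is adjacent to the spine vertex `x_{i+1}`. -/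
def CatRel (ℓ : ℕ) (d : ℕ → ℕ) : CatV ℓ d → CatV ℓ d → Prop
  | Sum.inl i, Sum.inl j => (j : ℕ) = (i : ℕ) + 1
  | Sum.inr p, Sum.inl k => (k : ℕ) = (p.1 : ℕ) + 1
  | _, _ => False

/-- The caterpillar tree `Cat(d 1, …, d ℓ)` with spine `x_0, …, x_{ℓ+1}`, in which
the spine vertex `x_i` has degree `d i` for `1 ≤ i ≤ ℓ` (provided `d i ≥ 2`). -/
def Cat (ℓ : ℕ) (d : ℕ → ℕ) : SimpleGraph (CatV ℓ d) :=
  SimpleGraph.fromRel (CatRel ℓ d)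

/-- There exists a strong edge-coloring `φ` of `Cat ℓ d` using colors from `C` with
`φ(E 1) = C₁`, `φ(E ℓ) = Cl`, `φ(x₀x₁) = α₀` and `φ(x_ℓ x_{ℓ+1}) = αl`. -/
def CatPrecolorExists (ℓ : ℕ) (d : ℕ → ℕ) (C C₁ Cl : Finset ℕ) (α₀ αl : ℕ) : Prop :=
  ∃ φ : Sym2 (CatV ℓ d) → ℕ,
    (∀ e ∈ (Cat ℓ d).edgeSet, φ e ∈ C) ∧
    IsStrongEdgeColoring (Cat ℓ d) φ ∧
    φ '' Einc (Cat ℓ d) (Sum.inl ⟨1, by omega⟩) = ↑C₁ ∧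
    φ '' Einc (Cat ℓ d) (Sum.inl ⟨ℓ, by omega⟩) = ↑Cl ∧
    φ s(Sum.inl ⟨0, by omega⟩, Sum.inl ⟨1, by omega⟩) = α₀ ∧
    φ s(Sum.inl ⟨ℓ, by omega⟩, Sum.inl ⟨ℓ + 1, by omega⟩) = αl

/-- `Cat ℓ d` is `κ`-two-sided strong edge-pre-colorable: for every `κ`-set `C` of colors,
all `C₁, Cl ⊆ C` with `|C₁| = d 1`, `|Cl| = d ℓ`, and all `α₀ ∈ C₁`, `αl ∈ Cl`, there is
a strong edge-coloring `φ` of `Cat ℓ d` with colors from `C` such that `φ(E 1) = C₁`,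
`φ(E ℓ) = Cl`, `φ(x₀x₁) = α₀` and `φ(x_ℓ x_{ℓ+1}) = αl`. -/
def TwoSidedPrecolorable (ℓ : ℕ) (d : ℕ → ℕ) (κ : ℕ) : Prop :=
  ∀ C C₁ Cl : Finset ℕ, C.card = κ → C₁ ⊆ C → Cl ⊆ C →
    C₁.card = d 1 → Cl.card = d ℓ →
    ∀ α₀ ∈ C₁, ∀ αl ∈ Cl, CatPrecolorExists ℓ d C C₁ Cl α₀ αl

/-- `ℓ_σ` from the refined key lemma: `ℓ_5 = 8`, `ℓ_6 = ℓ_7 = 7`, `ℓ_σ = σ` for `σ ≥ 8`. -/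
def ellSigma (s : ℕ) : ℕ :=
  if s = 5 then 8 else if s ≤ 7 then 7 else s

/-- Recursive form of the colouring problem: `A` is the current colour set, `α` the colour of
the incoming spine edge, `L` the number of remaining steps, `B`, `β` the target. -/
def Sol : ℕ → (ℕ → ℕ) → Finset ℕ → Finset ℕ → ℕ → Finset ℕ → ℕ → Prop
  | 0, _, _, A, α, B, β => A = B ∧ α ≠ β
  | L + 1, d, C, A, α, B, β => ∃ a A', a ∈ A ∧ a ≠ α ∧ A' ⊆ C ∧ A'.card = d 1 ∧ A ∩ A' = {a} ∧
      Sol L (fun i => d (i + 1)) C A' a B β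

theorem Sol.lift (e : ℕ) : ∀ (L : ℕ) (d d' : ℕ → ℕ) (E : ℕ → Bool) (C A : Finset ℕ) (α : ℕ)
    (B : Finset ℕ) (β α' : ℕ), Sol L d' (C.erase e) A α B β → A ⊆ C.erase e → e ∈ C → e ≠ β →
    (α' = α ∨ α' = e) →
    (∀ i, 1 ≤ i → i ≤ L → d i = d' i + if E i then 1 else 0) →
    (∀ i, i < L → ¬ (E i = true ∧ E (i + 1) = true)) →
    Sol L d C (if E 0 then insert e A else A) α' (if E L then insert e B else B) β := by
  intro L
  induction L with
  | zero =>
    intro d d' E C A α B β α' h hA he hβ hα hd hE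
    obtain ⟨rfl, h2⟩ := h
    refine ⟨rfl, ?_⟩
    rcases hα with rfl | rfl <;> assumption
  | succ L ih =>
    intro d d' E C A α B β α' h hA he hβ hα hd hE
    obtain ⟨a, A', ha, haα, hA', hc, hi, hs⟩ := h
    have hae : a ≠ e := fun h => by
      have := hA ha
      simp [h] at this
    have heA : e ∉ A := fun h => by
      have := hA h
      simp at this
    have heA' : e ∉ A' := fun h => by
      have := hA' h
      simp at this
    have key := ih (fun i => d (i + 1)) (fun i => d' (i + 1)) (fun i => E (i + 1)) C A' a B β a hs
      hA' he hβ (Or.inl rfl) (fun i h1 h2 => hd (i + 1) (by omega) (by omega))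
      (fun i h1 => hE (i + 1) (by omega))
    refine ⟨a, if E 1 then insert e A' else A', ?_, ?_, ?_, ?_, ?_, key⟩
    · split_ifs <;> simp [ha]
    · rcases hα with rfl | rfl <;> assumption
    · have : A' ⊆ C := hA'.trans (Finset.erase_subset _ _)
      split_ifs
      · exact Finset.insert_subset he this
      · exact this
    · rw [hd 1 le_rfl (by omega)]
      split_ifs
      · rw [Finset.card_insert_of_notMem heA', hc]
      · simpa using hc
    · have h0 := hE 0 (by omega)
      rw [← hi]
      split_ifs with h1 h2 h2
      · exact absurd ⟨h1, h2⟩ h0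
      · rw [Finset.insert_inter_of_notMem heA']
      · rw [Finset.inter_insert_of_notMem heA]
      · rfl

/-- Degree constraints. -/
def Okd (n L : ℕ) (d : ℕ → ℕ) : Prop :=
  (∀ i, i ≤ L → 2 ≤ d i ∧ d i + 2 ≤ n) ∧ ∀ i, i < L → d i + d (i + 1) ≤ n + 1

def GoodNL (n L : ℕ) : Prop :=
  ∀ (d : ℕ → ℕ) (C A : Finset ℕ) (α : ℕ) (B : Finset ℕ) (β : ℕ), Okd n L d → C.card = n →
    A ⊆ C → B ⊆ C → A.card = d 0 → B.card = d L → α ∈ A → β ∈ B → Sol L d C A α B β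

/-- Lock one colour `e` (with pattern `E`) after one step. -/
theorem lock (n L : ℕ) (IH : GoodNL n L) (d : ℕ → ℕ) (C A : Finset ℕ) (α : ℕ) (B : Finset ℕ)
    (β : ℕ) (hd : Okd (n + 1) (L + 1) d) (hC : C.card = n + 1) (hB : B ⊆ C)
    (hBc : B.card = d (L + 1)) (hβ : β ∈ B)
    (E : ℕ → Bool) (e a : ℕ) (A' : Finset ℕ) (he : e ∈ C) (heβ : e ≠ β)
    (heB : e ∈ B ↔ E (L + 1) = true) (ha : a ∈ A) (haα : a ≠ α) (hA' : A' ⊆ C)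
    (hA'c : A'.card = d 1) (hi : A ∩ A' = {a}) (heA' : e ∈ A' ↔ E 1 = true)
    (hE3 : ∀ i, 1 ≤ i → i ≤ L + 1 → E i = true → 3 ≤ d i)
    (hEbig : ∀ i, 1 ≤ i → i ≤ L + 1 → d i + 1 = n → E i = true)
    (hEt : ∀ i, 1 ≤ i → i ≤ L → d i + d (i + 1) = n + 2 → E i = true ∨ E (i + 1) = true)
    (hEn : ∀ i, 1 ≤ i → i ≤ L → ¬ (E i = true ∧ E (i + 1) = true)) :
    Sol (L + 1) d C A α B β := by
  have haA' : a ∈ A' := by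
    have : a ∈ A ∩ A' := by rw [hi]; simp
    exact (Finset.mem_inter.1 this).2
  set d' : ℕ → ℕ := fun i => d (i + 1) - if E (i + 1) then 1 else 0 with hd'
  have hdd : ∀ i, i ≤ L → d (i + 1) = d' i + if E (i + 1) then 1 else 0 := by
    intro i hi
    have := (hd.1 (i + 1) (by omega)).1
    simp only [hd']
    split_ifs <;> omega
  have hok : Okd n L d' := by
    refine ⟨fun i hi => ?_, fun i hi => ?_⟩
    · have h1 := hd.1 (i + 1) (by omega)
      have h2 := hdd i hi
      have h3 := hE3 (i + 1) (by omega) (by omega)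
      have h4 := hEbig (i + 1) (by omega) (by omega)
      split_ifs at h2 with h
      · have := h3 h; omega
      · have : ¬ (d (i + 1) + 1 = n) := fun hh => h (h4 hh)
        omega
    · have h1 := hd.2 (i + 1) (by omega)
      have h2 := hdd i (by omega)
      have h3 := hdd (i + 1) (by omega)
      have h4 := hEt (i + 1) (by omega) (by omega)
      split_ifs at h2 h3 with h5 h6
      · omega
      · omega
      · omega
      · have : ¬ (d (i + 1) + d (i + 1 + 1) = n + 2) := fun hh => by
          rcases h4 hh with h | h <;> contradiction
        omega
  have hcA : (A'.erase e).card = d' 0 := by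
    have h2 := hdd 0 (by omega)
    simp only [zero_add] at h2
    split_ifs at h2 with h
    · rw [Finset.card_erase_of_mem (heA'.2 h)]; omega
    · rw [Finset.erase_eq_of_notMem (fun hh => h (heA'.1 hh))]; omega
  have hcB : (B.erase e).card = d' L := by
    have h2 := hdd L le_rfl
    split_ifs at h2 with h
    · rw [Finset.card_erase_of_mem (heB.2 h)]; omega
    · rw [Finset.erase_eq_of_notMem (fun hh => h (heB.1 hh))]; omega
  obtain ⟨α', hα', hα''⟩ : ∃ α' ∈ A'.erase e, a = α' ∨ a = e := by
    by_cases hae : a = e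
    · have : 0 < (A'.erase e).card := by
        rw [hcA]; have := (hok.1 0 (by omega)).1; omega
      obtain ⟨x, hx⟩ := Finset.card_pos.1 this
      exact ⟨x, hx, Or.inr hae⟩
    · exact ⟨a, Finset.mem_erase.2 ⟨hae, haA'⟩, Or.inl rfl⟩
  have key := IH d' (C.erase e) (A'.erase e) α' (B.erase e) β hok
    (by rw [Finset.card_erase_of_mem he]; omega) (Finset.erase_subset_erase _ hA')
    (Finset.erase_subset_erase _ hB) hcA hcB hα' (Finset.mem_erase.2 ⟨heβ.symm, hβ⟩)
  have key2 := Sol.lift e L (fun i => d (i + 1)) d' (fun i => E (i + 1)) C _ α' _ β a key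
    (Finset.erase_subset_erase _ hA') he heβ hα'' (fun i _ h2 => hdd i h2)
    (fun i h => hEn (i + 1) (by omega) (by omega))
  refine ⟨a, A', ha, haα, hA', hA'c, hi, ?_⟩
  have e1 : (if E (0 + 1) = true then insert e (A'.erase e) else A'.erase e) = A' := by
    simp only [zero_add]
    split_ifs with h
    · exact Finset.insert_erase (heA'.2 h)
    · exact Finset.erase_eq_of_notMem (fun hh => h (heA'.1 hh))
  have e2 : (if E (L + 1) = true then insert e (B.erase e) else B.erase e) = B := by
    split_ifs with h
    · exact Finset.insert_erase (heB.2 h)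
    · exact Finset.erase_eq_of_notMem (fun hh => h (heB.1 hh))
  simp only [e1, e2] at key2
  exact key2

/-- Membership pattern of a locked colour. -/
def Epat (n m L : ℕ) (d : ℕ → ℕ) (i : ℕ) : Prop :=
  (i % 2 = L % 2 ∧ m + 1 ≤ d i) ∨ (i % 2 ≠ L % 2 ∧ n + 1 ≤ d i + m)

/-- Existence of a next set with the required membership of `e`. -/
theorem next_set (C A : Finset ℕ) (a e k n : ℕ) (hC : C.card = n) (hA : A ⊆ C) (he : e ∈ C)
    (ha : a ∈ A) (hk : 2 ≤ k) (hs : A.card + k ≤ n + 1) (P : Prop)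
    (h : (P ∧ (e ∈ A → a = e)) ∨ (¬ P ∧ e ∈ A ∧ a ≠ e) ∨ (¬ P ∧ e ∉ A ∧ A.card + k ≤ n)) :
    ∃ A', A' ⊆ C ∧ A'.card = k ∧ A ∩ A' = {a} ∧ (e ∈ A' ↔ P) := by
  have hcard : (C \ A).card = n - A.card := by
    rw [Finset.card_sdiff_of_subset hA, hC]
  have main : ∀ lo hi : Finset ℕ, lo ⊆ hi → hi ⊆ C \ A → lo.card ≤ k - 1 → k - 1 ≤ hi.card →
      ∃ T, lo ⊆ T ∧ T ⊆ hi ∧ insert a T ⊆ C ∧ (insert a T).card = k ∧ A ∩ insert a T = {a} := by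
    intro lo hi h1 h2 h3 h4
    obtain ⟨T, hT1, hT2, hT3⟩ := Finset.exists_subsuperset_card_eq h1 h3 h4
    have hTA : ∀ x ∈ T, x ∈ C ∧ x ∉ A := fun x hx => Finset.mem_sdiff.1 (h2 (hT2 hx))
    refine ⟨T, hT1, hT2, ?_, ?_, ?_⟩
    · exact Finset.insert_subset (hA ha) (fun x hx => (hTA x hx).1)
    · rw [Finset.card_insert_of_notMem (fun hh => (hTA a hh).2 ha)]; omega
    · ext x
      simp only [Finset.mem_inter, Finset.mem_insert, Finset.mem_singleton]
      constructor
      · rintro ⟨hx, rfl | hx2⟩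
        · rfl
        · exact absurd hx (hTA x hx2).2
      · rintro rfl
        exact ⟨ha, Or.inl rfl⟩
  rcases h with ⟨hP, hh⟩ | ⟨hP, heA, hae⟩ | ⟨hP, heA, hl⟩
  · by_cases heA : e ∈ A
    · obtain ⟨T, hT1, hT2, hT3, hT4, hT5⟩ := main ∅ (C \ A) (by simp) le_rfl (by simp) (by omega)
      exact ⟨_, hT3, hT4, hT5, by simp [hP, hh heA]⟩
    · obtain ⟨T, hT1, hT2, hT3, hT4, hT5⟩ := main {e} (C \ A) (by simp [he, heA]) le_rfl
        (by simp; omega) (by omega)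
      exact ⟨_, hT3, hT4, hT5, by simpa [hP] using Or.inr (hT1 (by simp))⟩
  · obtain ⟨T, hT1, hT2, hT3, hT4, hT5⟩ := main ∅ (C \ A) (by simp) le_rfl (by simp) (by omega)
    refine ⟨_, hT3, hT4, hT5, ?_⟩
    have : e ∉ T := fun h => (Finset.mem_sdiff.1 (hT2 h)).2 heA
    simp [hP, this, Ne.symm hae]
  · have hc2 : ((C \ A).erase e).card = n - A.card - 1 := by
      rw [Finset.card_erase_of_mem (by simp [he, heA]), hcard]
    obtain ⟨T, hT1, hT2, hT3, hT4, hT5⟩ := main ∅ ((C \ A).erase e) (by simp)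
      (Finset.erase_subset _ _) (by simp) (by omega)
    refine ⟨_, hT3, hT4, hT5, ?_⟩
    have : e ∉ T := fun h => by
      have := hT2 h
      simp at this
    have hae : e ≠ a := fun h => heA (h ▸ ha)
    simp [hP, this, hae]

theorem lockm (n L : ℕ) (IH : GoodNL n L) (d : ℕ → ℕ) (C A : Finset ℕ) (α : ℕ) (B : Finset ℕ)
    (β : ℕ) (hd : Okd (n + 1) (L + 1) d) (hC : C.card = n + 1) (hA : A ⊆ C) (hB : B ⊆ C)
    (hAc : A.card = d 0) (hα : α ∈ A)
    (hBc : B.card = d (L + 1)) (hβ : β ∈ B) (m e : ℕ) (hm : 3 ≤ m) (hm2 : m + 2 ≤ n)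
    (he : e ∈ C) (heβ : e ≠ β) (heB : e ∈ B ↔ m + 1 ≤ d (L + 1))
    (h : (Epat (n + 1) m (L + 1) d 1 ∧ e ≠ α) ∨
      (¬ Epat (n + 1) m (L + 1) d 1 ∧ e ∈ A ∧ 3 ≤ d 0) ∨
      (¬ Epat (n + 1) m (L + 1) d 1 ∧ e ∉ A ∧ d 0 + d 1 ≤ n + 1)) :
    Sol (L + 1) d C A α B β := by
  classical
  have hd0 := hd.1 0 (by omega)
  have hd1 := hd.1 1 (by omega)
  have hs := hd.2 0 (by omega)
  obtain ⟨a, ha, haα, h'⟩ : ∃ a ∈ A, a ≠ α ∧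
      ((Epat (n + 1) m (L + 1) d 1 ∧ (e ∈ A → a = e)) ∨
      (¬ Epat (n + 1) m (L + 1) d 1 ∧ e ∈ A ∧ a ≠ e) ∨
      (¬ Epat (n + 1) m (L + 1) d 1 ∧ e ∉ A ∧ A.card + d 1 ≤ n + 1)) := by
    obtain ⟨a0, ha0, ha0α⟩ : ∃ a ∈ A, a ≠ α := Finset.exists_mem_ne (by omega) α
    rcases h with ⟨h1, h2⟩ | ⟨h1, h2, h3⟩ | ⟨h1, h2, h3⟩
    · by_cases heA : e ∈ A
      · exact ⟨e, heA, h2, Or.inl ⟨h1, fun _ => rfl⟩⟩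
      · exact ⟨a0, ha0, ha0α, Or.inl ⟨h1, fun hh => absurd hh heA⟩⟩
    · obtain ⟨a, ha, hae⟩ : ∃ a ∈ A.erase α, a ≠ e := by
        apply Finset.exists_mem_ne
        rw [Finset.card_erase_of_mem hα]; omega
      rw [Finset.mem_erase] at ha
      exact ⟨a, ha.2, ha.1, Or.inr (Or.inl ⟨h1, h2, hae⟩)⟩
    · exact ⟨a0, ha0, ha0α, Or.inr (Or.inr ⟨h1, h2, by omega⟩)⟩
  obtain ⟨A', h1, h2, h3, h4⟩ := next_set C A a e (d 1) (n + 1) hC hA he ha hd1.1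
    (by rw [hAc]; exact hs) _ h'
  refine lock n L IH d C A α B β hd hC hB hBc hβ
    (fun i => decide (Epat (n + 1) m (L + 1) d i)) e a A' he heβ ?_ ha haα h1 h2 h3 ?_ ?_ ?_ ?_ ?_
  · rw [heB]; simp [Epat]
  · rw [h4]; simp
  · intro i hi1 hi2 hE
    rw [decide_eq_true_eq] at hE
    unfold Epat at hE
    omega
  · intro i hi1 hi2 hE
    rw [decide_eq_true_eq]
    unfold Epat
    omega
  · intro i hi1 hi2 hE
    rw [decide_eq_true_eq, decide_eq_true_eq]
    unfold Epat
    omega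
  · intro i hi1 hi2
    rw [decide_eq_true_eq, decide_eq_true_eq]
    unfold Epat
    have := hd.2 i (by omega)
    omega

theorem good_succ (n L : ℕ) (hn : 5 ≤ n) (IH : GoodNL n L) : GoodNL (n + 1) (L + 1) := by
  classical
  intro d C A α B β hd hC hA hB hAc hBc hα hβ
  have hd0 := hd.1 0 (by omega)
  have hd1 := hd.1 1 (by omega)
  have hdl := hd.1 (L + 1) (by omega)
  have hs := hd.2 0 (by omega)
  simp only [zero_add] at hs
  have go := lockm n L IH d C A α B β hd hC hA hB hAc hα hBc hβ
  have hCB : (C \ B).card = n + 1 - d (L + 1) := by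
    rw [Finset.card_sdiff_of_subset hB, hC, hBc]
  have hBb : (B.erase β).card = d (L + 1) - 1 := by
    rw [Finset.card_erase_of_mem hβ, hBc]
  by_cases hcase : d (L + 1) + 2 ≤ n
  · -- use a colour outside `B`
    have go' : ∀ e, e ∈ C → e ∉ B → _ := fun e h1 h2 => go (n - 2) e (by omega) (by omega) h1
      (fun h => h2 (h ▸ hβ)) ⟨fun h => absurd h h2, fun h => by omega⟩
    by_cases hE : Epat (n + 1) (n - 2) (L + 1) d 1
    · obtain ⟨e, he, hne⟩ : ∃ e ∈ C \ B, e ≠ α := Finset.exists_mem_ne (by omega) α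
      rw [Finset.mem_sdiff] at he
      exact go' e he.1 he.2 (Or.inl ⟨hE, hne⟩)
    · by_cases ht : d 0 + d 1 ≤ n + 1
      · by_cases h3 : 3 ≤ d 0
        · obtain ⟨e, he⟩ : (C \ B).Nonempty := Finset.card_pos.1 (by omega)
          rw [Finset.mem_sdiff] at he
          by_cases heA : e ∈ A
          · exact go' e he.1 he.2 (Or.inr (Or.inl ⟨hE, heA, h3⟩))
          · exact go' e he.1 he.2 (Or.inr (Or.inr ⟨hE, heA, ht⟩))
        · obtain ⟨e, he, heA⟩ : ∃ e ∈ C \ B, e ∉ A :=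
            Finset.exists_mem_notMem_of_card_lt_card (by omega)
          rw [Finset.mem_sdiff] at he
          exact go' e he.1 he.2 (Or.inr (Or.inr ⟨hE, heA, ht⟩))
      · by_cases hAB : A ⊆ B
        · have := Finset.card_le_card hAB
          obtain ⟨e, he, hne⟩ : ∃ e ∈ B.erase β, e ≠ α := Finset.exists_mem_ne
            (by simp only [Epat] at hE; omega) α
          rw [Finset.mem_erase] at he
          refine go 3 e le_rfl (by omega) (hB he.2) he.1 ⟨fun _ => ?_, fun _ => he.2⟩
            (Or.inl ⟨?_, hne⟩)
          · simp only [Epat] at hE; omega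
          · simp only [Epat] at hE ⊢; omega
        · obtain ⟨e, heA, heB⟩ := Finset.not_subset.1 hAB
          exact go' e (hA heA) heB (Or.inr (Or.inl ⟨hE, heA, by omega⟩))
  · have hdl2 : d (L + 1) = n - 1 := by omega
    have go' : ∀ e, e ∈ B.erase β → _ := fun e h1 => go 3 e le_rfl (by omega)
      (hB (Finset.mem_erase.1 h1).2) (Finset.mem_erase.1 h1).1
      ⟨fun h => by omega, fun h => (Finset.mem_erase.1 h1).2⟩
    by_cases hE : Epat (n + 1) 3 (L + 1) d 1
    · obtain ⟨e, he, hne⟩ : ∃ e ∈ B.erase β, e ≠ α := Finset.exists_mem_ne (by omega) α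
      exact go' e he (Or.inl ⟨hE, hne⟩)
    · by_cases ht : d 0 + d 1 ≤ n + 1
      · by_cases h3 : 3 ≤ d 0
        · obtain ⟨e, he⟩ : (B.erase β).Nonempty := Finset.card_pos.1 (by omega)
          by_cases heA : e ∈ A
          · exact go' e he (Or.inr (Or.inl ⟨hE, heA, h3⟩))
          · exact go' e he (Or.inr (Or.inr ⟨hE, heA, ht⟩))
        · obtain ⟨e, he, heA⟩ : ∃ e ∈ B.erase β, e ∉ A :=
            Finset.exists_mem_notMem_of_card_lt_card (by omega)
          exact go' e he (Or.inr (Or.inr ⟨hE, heA, ht⟩))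
      · have hAB : ((B.erase β) ∩ A).Nonempty := by
          by_contra hcon
          rw [Finset.not_nonempty_iff_eq_empty, ← Finset.disjoint_iff_inter_eq_empty] at hcon
          have h1 := Finset.card_union_of_disjoint hcon
          have h2 : ((B.erase β) ∪ A).card ≤ C.card := Finset.card_le_card
            (Finset.union_subset ((Finset.erase_subset _ _).trans hB) hA)
          simp only [Epat] at hE
          omega
        obtain ⟨e, he⟩ := hAB
        rw [Finset.mem_inter] at he
        exact go' e he.1 (Or.inr (Or.inl ⟨hE, he.2, by omega⟩))

theorem good_longer (n L : ℕ) (IH : GoodNL n L) : GoodNL n (L + 1) := by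
  intro d C A α B β hd hC hA hB hAc hBc hα hβ
  have hd0 := hd.1 0 (by omega)
  have hd1 := hd.1 1 (by omega)
  have hs := hd.2 0 (by omega)
  simp only [zero_add] at hs
  obtain ⟨a, ha, haα⟩ : ∃ a ∈ A, a ≠ α := Finset.exists_mem_ne (by omega) α
  obtain ⟨A', h1, h2, h3, h4⟩ := next_set C A a a (d 1) n hC hA (hA ha) ha hd1.1 (by omega) True
    (Or.inl ⟨trivial, fun _ => rfl⟩)
  refine ⟨a, A', ha, haα, h1, h2, h3, ?_⟩
  exact IH (fun i => d (i + 1)) C A' a B β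
    ⟨fun i hi => hd.1 (i + 1) (by omega), fun i hi => hd.2 (i + 1) (by omega)⟩ hC h1 hB h2 hBc
    (h4.2 trivial) hβ

theorem good_all (base : GoodNL 5 7) (n : ℕ) (hn : 5 ≤ n) (L : ℕ) (hL : n + 2 ≤ L) :
    GoodNL n L := by
  have h1 : GoodNL n (n + 2) := by
    induction n, hn using Nat.le_induction with
    | base => exact base
    | succ n hn ih => exact good_succ n (n + 2) hn (ih (by omega))
  induction L, hL using Nat.le_induction with
  | base => exact h1
  | succ L hL ih => exact good_longer n L ih

theorem good_big (n L : ℕ) (hL : 1 ≤ L) (h : GoodNL n L) (N : ℕ) (hN : n ≤ N) :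
    ∀ (d : ℕ → ℕ) (C A : Finset ℕ) (α : ℕ) (B : Finset ℕ) (β : ℕ), Okd n L d → C.card = N →
    A ⊆ C → B ⊆ C → A.card = d 0 → B.card = d L → α ∈ A → β ∈ B → Sol L d C A α B β := by
  induction N, hN using Nat.le_induction with
  | base => exact h
  | succ N hN ih =>
    intro d C A α B β hd hC hA hB hAc hBc hα hβ
    by_cases hex : ∃ e ∈ C, e ∉ A ∧ e ∉ B
    · obtain ⟨e, he, heA, heB⟩ := hex
      have hA' : A ⊆ C.erase e := Finset.subset_erase.2 ⟨hA, heA⟩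
      have := ih d (C.erase e) A α B β hd (by rw [Finset.card_erase_of_mem he]; omega) hA'
        (Finset.subset_erase.2 ⟨hB, heB⟩) hAc hBc hα hβ
      have := Sol.lift e L d d (fun _ => false) C A α B β α this hA' he (fun h => heB (h ▸ hβ))
        (Or.inl rfl) (by simp) (by simp)
      simpa using this
    · push Not at hex
      have hd0 := hd.1 0 (by omega)
      have hdl := hd.1 L (by omega)
      have hsub : C \ B ⊆ A \ B := fun x hx => by
        rw [Finset.mem_sdiff] at hx ⊢
        refine ⟨?_, hx.2⟩
        by_contra hh
        exact hx.2 (hex x hx.1 hh)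
      have h1 := Finset.card_le_card hsub
      rw [Finset.card_sdiff_of_subset hB] at h1
      have h2 : (A \ B).card ≤ A.card := Finset.card_le_card Finset.sdiff_subset
      obtain ⟨e, he, hne⟩ : ∃ e ∈ A \ B, e ≠ α := Finset.exists_mem_ne (by omega) α
      rw [Finset.mem_sdiff] at he
      have hA' : A.erase e ⊆ C.erase e := Finset.erase_subset_erase _ hA
      have := ih (fun i => if i = 0 then d 0 - 1 else d i) (C.erase e) (A.erase e) α B β
        ⟨?_, ?_⟩ (by rw [Finset.card_erase_of_mem (hA he.1)]; omega) hA'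
        (Finset.subset_erase.2 ⟨hB, he.2⟩)
        (by rw [Finset.card_erase_of_mem he.1, if_pos rfl]; omega)
        (by rw [if_neg (by omega)]; exact hBc) (Finset.mem_erase.2 ⟨hne.symm, hα⟩) hβ
      · have := Sol.lift e L d _ (fun i => decide (i = 0)) C _ α B β α this hA' (hA he.1)
          (fun h => he.2 (h ▸ hβ))
          (Or.inl rfl) (fun i h1 h2 => by simp [show i ≠ 0 by omega]) (by simp)
        simpa [Finset.insert_erase he.1, show L ≠ 0 by omega] using this
      · intro i hi
        have := hd.1 i hi
        dsimp only
        split_ifs <;> omega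
      · intro i hi
        have := hd.2 i hi
        dsimp only
        rw [if_neg (show ¬ (i + 1 = 0) by omega)]
        split_ifs with h0
        · subst h0; omega
        · omega

theorem shrink_head (L : ℕ) (d : ℕ → ℕ) (C A : Finset ℕ) (α : ℕ) (B : Finset ℕ) (β k : ℕ)
    (h : Sol (L + 1) d C A α B β) (hα : α ∈ A) (hk : 2 ≤ k) (hk2 : k ≤ A.card) :
    ∃ A0 ⊆ A, α ∈ A0 ∧ A0.card = k ∧ Sol (L + 1) d C A0 α B β := by
  obtain ⟨a, A', ha, haα, hA', hc, hi, hs⟩ := h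
  obtain ⟨A0, h1, h2, h3⟩ := Finset.exists_subsuperset_card_eq (s := {α, a}) (t := A) (n := k)
    (by intro x; simp only [Finset.mem_insert, Finset.mem_singleton]; rintro (rfl | rfl) <;> assumption)
    (le_trans (Finset.card_le_two) hk) hk2
  refine ⟨A0, h2, h1 (by simp), h3, a, A', h1 (by simp), haα, hA', hc, ?_, hs⟩
  have h4 : a ∈ A ∩ A' := by rw [hi]; simp
  apply Finset.Subset.antisymm
  · rw [← hi]; exact Finset.inter_subset_inter_right h2
  · rw [Finset.singleton_subset_iff]
    exact Finset.mem_inter.2 ⟨h1 (by simp), (Finset.mem_inter.1 h4).2⟩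

theorem shrink : ∀ (L : ℕ) (d d' : ℕ → ℕ) (C A : Finset ℕ) (α : ℕ) (B : Finset ℕ) (β : ℕ),
    Sol L d C A α B β → (∀ i, 1 ≤ i → i < L → 2 ≤ d' i ∧ d' i ≤ d i) → d' L = d L →
    Sol L d' C A α B β := by
  intro L
  induction L with
  | zero => intro d d' C A α B β h _ _; exact h
  | succ L ih =>
    intro d d' C A α B β h hd hL
    obtain ⟨a, A', ha, haα, hA', hc, hi, hs⟩ := h
    have key := ih (fun i => d (i + 1)) (fun i => d' (i + 1)) C A' a B β hs
      (fun i h1 h2 => hd (i + 1) (by omega) (by omega)) hL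
    have h4 : a ∈ A ∩ A' := by rw [hi]; simp
    cases L with
    | zero => exact ⟨a, A', ha, haα, hA', by rw [hc]; exact hL.symm, hi, key⟩
    | succ L =>
      have h1 := hd 1 le_rfl (by omega)
      obtain ⟨A0, g1, g2, g3, g4⟩ := shrink_head L _ C A' a B β (d' 1) key
        (Finset.mem_inter.1 h4).2 h1.1 (by omega)
      refine ⟨a, A0, ha, haα, g1.trans hA', g3, ?_, g4⟩
      apply Finset.Subset.antisymm
      · rw [← hi]; exact Finset.inter_subset_inter_left g1
      · rw [Finset.singleton_subset_iff]
        exact Finset.mem_inter.2 ⟨ha, g2⟩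

/-- Masks of the three-element subsets of a five-element set. -/
def threeM : List ℕ := [7, 11, 13, 14, 19, 21, 22, 25, 26, 28]

def fiveL : List ℕ := [0, 1, 2, 3, 4]

/-- Bitmask search for the base case. -/
def srch : ℕ → ℕ → ℕ → ℕ → ℕ → Bool
  | 0, s, f, t, b => fiveL.any fun a =>
      s.testBit a && !(Nat.beq a f) && !(Nat.beq a b) && Nat.beq (s &&& t) (2 ^ a)
  | k + 1, s, f, t, b => fiveL.any fun a =>
      s.testBit a && !(Nat.beq a f) && threeM.any fun s' =>
        Nat.beq (s &&& s') (2 ^ a) && srch k s' a t b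

/-- All masks of two- and three-element sets. -/
def allM : List ℕ := threeM ++ [3, 5, 6, 9, 10, 12, 17, 18, 20, 24]

def chk : Bool := allM.all fun s => allM.all fun t => fiveL.all fun f => fiveL.all fun b =>
  !(s.testBit f) || !(t.testBit b) || srch 6 s f t b

set_option maxRecDepth 100000 in
theorem chk_true : chk = true := by decide +kernel

/-- The colour set coded by a mask. -/
def maskSet (c : ℕ → ℕ) (s : ℕ) : Finset ℕ :=
  ((Finset.range 5).filter fun i => s.testBit i = true).image c

theorem mem_maskSet (c : ℕ → ℕ) (hc : Set.InjOn c (Finset.range 5)) (s i : ℕ) (hi : i < 5) :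
    c i ∈ maskSet c s ↔ s.testBit i = true := by
  simp only [maskSet, Finset.mem_image, Finset.mem_filter, Finset.mem_range]
  constructor
  · rintro ⟨j, ⟨h1, h2⟩, h3⟩
    have : j = i := hc (by simpa using h1) (by simpa using hi) h3
    exact this ▸ h2
  · intro h
    exact ⟨i, ⟨hi, h⟩, rfl⟩

theorem card_maskSet (c : ℕ → ℕ) (hc : Set.InjOn c (Finset.range 5)) (s : ℕ) :
    (maskSet c s).card = ((Finset.range 5).filter fun i => s.testBit i = true).card := by
  apply Finset.card_image_of_injOn
  exact hc.mono (by intro x hx; simp at hx ⊢; exact hx.1)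

theorem maskSet_subset (c : ℕ → ℕ) (s : ℕ) : maskSet c s ⊆ (Finset.range 5).image c :=
  Finset.image_subset_image (Finset.filter_subset _ _)

theorem maskSet_inter (c : ℕ → ℕ) (hc : Set.InjOn c (Finset.range 5)) (s t a : ℕ) (ha : a < 5)
    (h : s &&& t = 2 ^ a) : maskSet c s ∩ maskSet c t = {c a} := by
  have key : ∀ i, i < 5 → ((s.testBit i = true ∧ t.testBit i = true) ↔ i = a) := by
    intro i hi
    have := congrArg (fun x => Nat.testBit x i) h
    simp only [Nat.testBit_and, Nat.testBit_two_pow] at this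
    rw [← Bool.and_eq_true, this]
    simp [eq_comm]
  ext x
  rw [Finset.mem_inter, Finset.mem_singleton]
  constructor
  · rintro ⟨h1, h2⟩
    obtain ⟨i, hi, rfl⟩ := Finset.mem_image.1 (maskSet_subset c s h1)
    rw [Finset.mem_range] at hi
    rw [mem_maskSet c hc _ _ hi] at h1 h2
    rw [(key i hi).1 ⟨h1, h2⟩]
  · rintro rfl
    rw [mem_maskSet c hc _ _ ha, mem_maskSet c hc _ _ ha]
    exact (key a ha).2 rfl

theorem exists_maskSet (c : ℕ → ℕ) (A : Finset ℕ)
    (hA : A ⊆ (Finset.range 5).image c) : ∃ s < 32, A = maskSet c s := by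
  refine ⟨Nat.ofBits (n := 5) (fun i => decide (c i ∈ A)), Nat.ofBits_lt_two_pow _, ?_⟩
  have key : ∀ i, i < 5 → ((Nat.ofBits (n := 5) (fun i => decide (c i ∈ A))).testBit i = true ↔
      c i ∈ A) := by
    intro i hi
    rw [Nat.testBit_ofBits_lt _ _ hi]
    simp
  ext x
  simp only [maskSet, Finset.mem_image, Finset.mem_filter, Finset.mem_range]
  constructor
  · intro hx
    obtain ⟨i, hi, rfl⟩ := Finset.mem_image.1 (hA hx)
    rw [Finset.mem_range] at hi
    exact ⟨i, ⟨hi, (key i hi).2 hx⟩, rfl⟩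
  · rintro ⟨i, ⟨hi, h2⟩, rfl⟩
    exact (key i hi).1 h2

theorem threeM_card : ∀ s ∈ threeM, ((Finset.range 5).filter fun i => s.testBit i = true).card = 3 := by
  decide +kernel

theorem allM_mem : ∀ s < 32, (((Finset.range 5).filter fun i => s.testBit i = true).card = 2 ∨
    ((Finset.range 5).filter fun i => s.testBit i = true).card = 3) → s ∈ allM := by
  decide +kernel

theorem fiveL_mem (a : ℕ) : a ∈ fiveL ↔ a < 5 := by
  simp only [fiveL, List.mem_cons, List.not_mem_nil, or_false]
  omega

theorem srch_sound (c : ℕ → ℕ) (hc : Set.InjOn c (Finset.range 5)) (t b : ℕ) (hb : b < 5) :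
    ∀ (k : ℕ) (s f : ℕ) (d : ℕ → ℕ), f < 5 → srch k s f t b = true →
    (∀ i, 1 ≤ i → i ≤ k → d i = 3) → d (k + 1) = (maskSet c t).card →
    Sol (k + 1) d ((Finset.range 5).image c) (maskSet c s) (c f) (maskSet c t) (c b) := by
  have hinj : ∀ i j, i < 5 → j < 5 → i ≠ j → c i ≠ c j := fun i j h1 h2 h3 h4 =>
    h3 (hc (by simpa using h1) (by simpa using h2) h4)
  intro k
  induction k with
  | zero =>
    intro s f d hf h hd hd2
    simp only [srch, List.any_eq_true, fiveL_mem, Bool.and_eq_true, Bool.not_eq_true'] at h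
    obtain ⟨a, ha, ⟨⟨h1, h2⟩, h3⟩, h4⟩ := h
    have h2' := Nat.ne_of_beq_eq_false h2
    have h3' := Nat.ne_of_beq_eq_false h3
    exact ⟨c a, maskSet c t, (mem_maskSet c hc _ _ ha).2 h1, hinj _ _ ha hf h2',
      maskSet_subset _ _, hd2.symm, maskSet_inter c hc _ _ _ ha (Nat.eq_of_beq_eq_true h4), rfl, hinj _ _ ha hb h3'⟩
  | succ k ih =>
    intro s f d hf h hd hd2
    simp only [srch, List.any_eq_true, fiveL_mem, Bool.and_eq_true, Bool.not_eq_true'] at h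
    obtain ⟨a, ha, ⟨h1, h2⟩, s', hs', h3, h4⟩ := h
    have h2' := Nat.ne_of_beq_eq_false h2
    refine ⟨c a, maskSet c s', (mem_maskSet c hc _ _ ha).2 h1, hinj _ _ ha hf h2',
      maskSet_subset _ _, ?_, maskSet_inter c hc _ _ _ ha (Nat.eq_of_beq_eq_true h3), ?_⟩
    · rw [card_maskSet c hc, threeM_card s' hs', hd 1 le_rfl (by omega)]
    · exact ih s' a _ ha h4 (fun i h1 h2 => hd (i + 1) (by omega) (by omega)) hd2

theorem good_base : GoodNL 5 7 := by
  intro d C A α B β hd hC hA hB hAc hBc hα hβ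
  obtain ⟨c, hc, rfl⟩ : ∃ c : ℕ → ℕ, Set.InjOn c (Finset.range 5) ∧
      C = (Finset.range 5).image c := by
    have e := C.equivFinOfCardEq hC
    refine ⟨fun i => if h : i < 5 then (e.symm ⟨i, h⟩ : ℕ) else 0, ?_, ?_⟩
    · intro i hi j hj hij
      have hi' : i < 5 := by simpa using hi
      have hj' : j < 5 := by simpa using hj
      simp only [hi', hj', dif_pos] at hij
      have := e.symm.injective (Subtype.ext hij)
      simpa using this
    · ext x
      simp only [Finset.mem_image, Finset.mem_range]
      constructor
      · intro hx
        refine ⟨e ⟨x, hx⟩, (e ⟨x, hx⟩).2, ?_⟩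
        simp
      · rintro ⟨i, hi, rfl⟩
        simp [hi]
  obtain ⟨s, hs, rfl⟩ := exists_maskSet c A hA
  obtain ⟨t, ht, rfl⟩ := exists_maskSet c B hB
  obtain ⟨f, hf, rfl⟩ := Finset.mem_image.1 (hA hα)
  obtain ⟨b, hb, rfl⟩ := Finset.mem_image.1 (hB hβ)
  rw [Finset.mem_range] at hf hb
  rw [mem_maskSet c hc _ _ hf] at hα
  rw [mem_maskSet c hc _ _ hb] at hβ
  have hd0 := hd.1 0 (by omega)
  have hd7 := hd.1 7 (by omega)
  have hsM : s ∈ allM := allM_mem s hs (by rw [← card_maskSet c hc, hAc]; omega)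
  have htM : t ∈ allM := allM_mem t ht (by rw [← card_maskSet c hc, hBc]; omega)
  have h := chk_true
  simp only [chk, List.all_eq_true, fiveL_mem] at h
  have h' := h s hsM t htM f hf b hb
  simp only [hα, hβ, Bool.not_true, Bool.false_or] at h'
  have key := srch_sound c hc t b hb 6 s f (fun i => if i = 7 then d 7 else 3) hf h'
    (fun i h1 h2 => if_neg (by omega)) (by simp [hBc])
  refine shrink 7 _ d _ _ _ _ _ key (fun i h1 h2 => ?_) (by simp)
  have := hd.1 i (by omega)
  rw [if_neg (by omega)]
  omega

/-- Unfolding `Sol` into sequences. -/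
theorem Sol.seq : ∀ (L : ℕ) (d : ℕ → ℕ) (C A : Finset ℕ) (α : ℕ) (B : Finset ℕ) (β : ℕ),
    Sol L d C A α B β → A ⊆ C → A.card = d 0 → α ∈ A → β ∈ B →
    ∃ (S : ℕ → Finset ℕ) (a : ℕ → ℕ), S 0 = A ∧ a 0 = α ∧ S L = B ∧ a (L + 1) = β ∧
      (∀ i, i ≤ L → S i ⊆ C ∧ (S i).card = d i ∧ a i ∈ S i ∧ a (i + 1) ∈ S i ∧ a i ≠ a (i + 1)) ∧
      ∀ i, i < L → S i ∩ S (i + 1) = {a (i + 1)} := by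
  intro L
  induction L with
  | zero =>
    intro d C A α B β h hA hc hα hβ
    obtain ⟨rfl, h2⟩ := h
    refine ⟨fun _ => A, fun i => if i = 0 then α else β, rfl, rfl, rfl, rfl, ?_, by simp⟩
    intro i hi
    obtain rfl : i = 0 := by omega
    simp [hA, hc, hα, hβ, h2]
  | succ L ih =>
    intro d C A α B β h hA hc hα hβ
    obtain ⟨x, A', ha, haα, hA', hc', hi, hs⟩ := h
    have h4 : x ∈ A ∩ A' := by rw [hi]; simp
    obtain ⟨S, a, h1, h2, h3, h5, h6, h7⟩ := ih _ C A' x B β hs hA' hc' (Finset.mem_inter.1 h4).2 hβ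
    refine ⟨fun i => Nat.casesOn i A S, fun i => Nat.casesOn i α a, rfl, rfl, h3, h5, ?_, ?_⟩
    · intro i hi
      cases i with
      | zero =>
        refine ⟨hA, hc, hα, ?_, ?_⟩
        · change a 0 ∈ A
          rw [h2]; exact ha
        · change α ≠ a 0
          rw [h2]; exact haα.symm
      | succ i => exact h6 i (by omega)
    · intro i hi'
      cases i with
      | zero => simp only [h1, h2]; exact hi
      | succ i => exact h7 i (by omega)

theorem cat_adj_ss (ℓ : ℕ) (d : ℕ → ℕ) (i j : Fin (ℓ + 2)) :
    (Cat ℓ d).Adj (Sum.inl i) (Sum.inl j) ↔ (j : ℕ) = i + 1 ∨ (i : ℕ) = j + 1 := by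
  simp only [Cat, SimpleGraph.fromRel_adj, CatRel, ne_eq, Sum.inl.injEq, Fin.ext_iff]
  omega

theorem cat_adj_ls (ℓ : ℕ) (d : ℕ → ℕ) (p : Σ i : Fin ℓ, Fin (d (i.val + 1) - 2))
    (j : Fin (ℓ + 2)) :
    (Cat ℓ d).Adj (Sum.inr p) (Sum.inl j) ↔ (j : ℕ) = p.1 + 1 := by
  simp [Cat, SimpleGraph.fromRel_adj, CatRel]

theorem cat_adj_sl (ℓ : ℕ) (d : ℕ → ℕ) (p : Σ i : Fin ℓ, Fin (d (i.val + 1) - 2))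
    (j : Fin (ℓ + 2)) :
    (Cat ℓ d).Adj (Sum.inl j) (Sum.inr p) ↔ (j : ℕ) = p.1 + 1 := by
  simp [Cat, SimpleGraph.fromRel_adj, CatRel]

theorem cat_adj_ll (ℓ : ℕ) (d : ℕ → ℕ) (p q : Σ i : Fin ℓ, Fin (d (i.val + 1) - 2)) :
    ¬ (Cat ℓ d).Adj (Sum.inr p) (Sum.inr q) := by
  simp [Cat, SimpleGraph.fromRel_adj, CatRel]

theorem ndeg_ge (ℓ : ℕ) (d : ℕ → ℕ) (i : Fin ℓ) (hd : 2 ≤ d (i + 1)) :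
    d (i + 1) ≤ ndeg (Cat ℓ d) (Sum.inl ⟨i + 1, by omega⟩) := by
  let f : Option (Option (Fin (d (i.val + 1) - 2))) → CatV ℓ d
    | none => Sum.inl ⟨i, by omega⟩
    | some none => Sum.inl ⟨i + 2, by omega⟩
    | some (some k) => Sum.inr ⟨i, k⟩
  have hf : Function.Injective f := by
    rintro (_ | _ | k) (_ | _ | k') h <;> simp [f] at h ⊢ <;> exact h
  have h1 : (Set.range f).ncard = d (i + 1) := by
    rw [← Nat.card_coe_set_eq, Nat.card_range_of_injective hf]
    simp
    omega
  rw [ndeg, ← h1]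
  apply Set.ncard_le_ncard _ (Set.toFinite _)
  rintro _ ⟨_ | _ | k, rfl⟩
  · simp [f, cat_adj_ss]
  · simp [f, cat_adj_ss]
  · simp [f, cat_adj_sl]

theorem cat_okd (ℓ : ℕ) (d : ℕ → ℕ) (hd : ∀ i, 1 ≤ i → i ≤ ℓ → 2 ≤ d i) (hl : 1 ≤ ℓ)
    (hΔ : maxDeg (Cat ℓ d) + 2 ≤ sigmaG (Cat ℓ d)) :
    Okd (sigmaG (Cat ℓ d)) (ℓ - 1) (fun i => d (i + 1)) := by
  constructor
  · intro i hi
    have h1 := hd (i + 1) (by omega) (by omega)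
    have h2 := ndeg_ge ℓ d ⟨i, by omega⟩ h1
    have h3 : ndeg (Cat ℓ d) (Sum.inl ⟨i + 1, by omega⟩) ≤ maxDeg (Cat ℓ d) :=
      le_csSup (Set.finite_range _).bddAbove ⟨_, rfl⟩
    simp only at h2 ⊢
    omega
  · intro i hi
    have h1 := hd (i + 1) (by omega) (by omega)
    have h1' := hd (i + 1 + 1) (by omega) (by omega)
    have h2 := ndeg_ge ℓ d ⟨i, by omega⟩ h1
    have h2' := ndeg_ge ℓ d ⟨i + 1, by omega⟩ h1'
    have h3 : ndeg (Cat ℓ d) (Sum.inl ⟨i + 1, by omega⟩) +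
        ndeg (Cat ℓ d) (Sum.inl ⟨i + 1 + 1, by omega⟩) - 1 ≤ sigmaG (Cat ℓ d) := by
      apply le_csSup
      · apply Set.Finite.bddAbove
        apply (Set.finite_range (fun p : CatV ℓ d × CatV ℓ d =>
          ndeg (Cat ℓ d) p.1 + ndeg (Cat ℓ d) p.2 - 1)).subset
        rintro m ⟨x, y, _, rfl⟩
        exact ⟨(x, y), rfl⟩
      · exact ⟨_, _, by simp [cat_adj_ss], rfl⟩
    simp only at h2 h2' ⊢
    omega

/-- Edges at a spine vertex. -/
theorem inc_cases (ℓ : ℕ) (d : ℕ → ℕ) (i : Fin ℓ) (e : Sym2 (CatV ℓ d)) :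
    e ∈ Einc (Cat ℓ d) (Sum.inl ⟨i + 1, by omega⟩) ↔
    e = s(Sum.inl ⟨i, by omega⟩, Sum.inl ⟨i + 1, by omega⟩) ∨
    e = s(Sum.inl ⟨i + 1, by omega⟩, Sum.inl ⟨i + 1 + 1, by omega⟩) ∨
    ∃ k, e = s(Sum.inr ⟨i, k⟩, Sum.inl ⟨i + 1, by omega⟩) := by
  constructor
  · rintro ⟨h1, h2⟩
    obtain ⟨y, rfl⟩ := Sym2.mem_iff_exists.1 h2
    rw [SimpleGraph.mem_edgeSet] at h1
    rcases y with j | ⟨p, k⟩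
    · rw [cat_adj_ss] at h1
      rcases h1 with h1 | h1
      · right; left
        congr 3
        exact Fin.ext h1
      · left
        rw [Sym2.eq_swap]
        congr 3
        apply Fin.ext
        simp only at h1 ⊢
        omega
    · rw [cat_adj_sl] at h1
      right; right
      have : p = i := by
        apply Fin.ext
        simp only at h1
        omega
      subst this
      exact ⟨k, Sym2.eq_swap⟩
  · rintro (rfl | rfl | ⟨k, rfl⟩)
    · exact ⟨by rw [SimpleGraph.mem_edgeSet, cat_adj_ss]; simp, by simp⟩
    · exact ⟨by rw [SimpleGraph.mem_edgeSet, cat_adj_ss]; simp, by simp⟩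
    · exact ⟨by rw [SimpleGraph.mem_edgeSet, cat_adj_ls], by simp⟩

/-- The inner spine vertex (shifted by one) nearest to a vertex. -/
def cen (ℓ : ℕ) (d : ℕ → ℕ) : CatV ℓ d → ℕ
  | Sum.inl k => min ((k : ℕ) - 1) (ℓ - 1)
  | Sum.inr p => p.1

theorem cen_lt (ℓ : ℕ) (d : ℕ → ℕ) (hl : 1 ≤ ℓ) (u : CatV ℓ d) : cen ℓ d u < ℓ := by
  rcases u with k | p
  · simp only [cen]; omega
  · exact p.1.2

theorem cen_inc (ℓ : ℕ) (d : ℕ → ℕ) (hl : 2 ≤ ℓ) (u : CatV ℓ d) (e : Sym2 (CatV ℓ d))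
    (he : e ∈ (Cat ℓ d).edgeSet) (hu : u ∈ e) :
    e ∈ Einc (Cat ℓ d) (Sum.inl ⟨cen ℓ d u + 1, by have := cen_lt ℓ d (by omega) u; omega⟩) := by
  refine ⟨he, ?_⟩
  obtain ⟨y, rfl⟩ := Sym2.mem_iff_exists.1 hu
  rw [SimpleGraph.mem_edgeSet] at he
  rw [Sym2.mem_iff]
  rcases u with k | p <;> rcases y with j | q
  · rw [cat_adj_ss] at he
    simp only [cen, Sum.inl.injEq, Fin.ext_iff]
    have := k.2
    have := j.2
    omega
  · rw [cat_adj_sl] at he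
    left
    simp only [cen, Sum.inl.injEq, Fin.ext_iff]
    have := q.1.2
    omega
  · rw [cat_adj_ls] at he
    right
    simp only [cen, Sum.inl.injEq, Fin.ext_iff]
    omega
  · exact absurd he (cat_adj_ll ℓ d p q)

theorem cen_adj (ℓ : ℕ) (d : ℕ → ℕ) (u v : CatV ℓ d) (h : (Cat ℓ d).Adj u v) :
    cen ℓ d u = cen ℓ d v ∨ cen ℓ d v = cen ℓ d u + 1 ∨ cen ℓ d u = cen ℓ d v + 1 := by
  rcases u with k | p <;> rcases v with j | q
  · rw [cat_adj_ss] at h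
    simp only [cen]
    omega
  · rw [cat_adj_sl] at h
    simp only [cen]
    have := q.1.2
    omega
  · rw [cat_adj_ls] at h
    simp only [cen]
    have := p.1.2
    omega
  · exact absurd h (cat_adj_ll ℓ d p q)

/-- Colour of a pair of vertices. -/
def colF (ℓ : ℕ) (d : ℕ → ℕ) (a : ℕ → ℕ) (g : (i : Fin ℓ) → Fin (d (i.val + 1) - 2) → ℕ) :
    CatV ℓ d → CatV ℓ d → ℕ
  | Sum.inl i, Sum.inl j => a (min i j)
  | Sum.inr p, Sum.inl _ => g p.1 p.2
  | Sum.inl _, Sum.inr p => g p.1 p.2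
  | Sum.inr _, Sum.inr _ => 0

theorem colF_symm (ℓ : ℕ) (d : ℕ → ℕ) (a : ℕ → ℕ)
    (g : (i : Fin ℓ) → Fin (d (i.val + 1) - 2) → ℕ) (u v : CatV ℓ d) :
    colF ℓ d a g u v = colF ℓ d a g v u := by
  rcases u with k | p <;> rcases v with j | q <;> simp [colF, min_comm]

theorem cat_of_seq (ℓ : ℕ) (d : ℕ → ℕ) (hl : 2 ≤ ℓ) (hd : ∀ i, 1 ≤ i → i ≤ ℓ → 2 ≤ d i)
    (C : Finset ℕ) (S : ℕ → Finset ℕ) (a : ℕ → ℕ)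
    (h1 : ∀ i, i < ℓ → S i ⊆ C ∧ (S i).card = d (i + 1) ∧ a i ∈ S i ∧ a (i + 1) ∈ S i ∧
      a i ≠ a (i + 1))
    (h2 : ∀ i, i + 1 < ℓ → S i ∩ S (i + 1) = {a (i + 1)}) :
    CatPrecolorExists ℓ d C (S 0) (S (ℓ - 1)) (a 0) (a ℓ) := by
  have hg : ∀ i : Fin ℓ, ∃ g : Fin (d (i.val + 1) - 2) → ℕ, Function.Injective g ∧
      ∀ x, (∃ k, g k = x) ↔ x ∈ S i ∧ x ≠ a i ∧ x ≠ a (i + 1) := by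
    intro i
    obtain ⟨_, h4, h5, h6, h7⟩ := h1 i i.2
    have hc : (((S i).erase (a i)).erase (a (i + 1))).card = d (i + 1) - 2 := by
      rw [Finset.card_erase_of_mem (Finset.mem_erase.2 ⟨h7.symm, h6⟩),
        Finset.card_erase_of_mem h5, h4]
      omega
    have e := Finset.equivFinOfCardEq hc
    refine ⟨fun k => (e.symm k : ℕ), fun k k' h => e.symm.injective (Subtype.ext h), fun x => ?_⟩
    constructor
    · rintro ⟨k, rfl⟩
      have := (e.symm k).2
      simp only [Finset.mem_erase] at this
      exact ⟨this.2.2, this.2.1, this.1⟩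
    · rintro ⟨g1, g2, g3⟩
      exact ⟨e ⟨x, by simp [g1, g2, g3]⟩, by simp⟩
  choose g hgi hgm using hg
  let φ : Sym2 (CatV ℓ d) → ℕ := Sym2.lift ⟨colF ℓ d a g, colF_symm ℓ d a g⟩
  have c1 : ∀ i (hi : i < ℓ + 1), φ s(Sum.inl ⟨i, by omega⟩, Sum.inl ⟨i + 1, by omega⟩) = a i := by
    intro i hi
    simp [φ, colF]
  have c2 : ∀ (i : Fin ℓ) k j, φ s(Sum.inr ⟨i, k⟩, Sum.inl j) = g i k := by
    intro i k j
    simp [φ, colF]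
  -- image of the edges at an inner spine vertex
  have im : ∀ i : Fin ℓ, φ '' Einc (Cat ℓ d) (Sum.inl ⟨i + 1, by omega⟩) = ↑(S i) := by
    intro i
    obtain ⟨_, h4, h5, h6, h7⟩ := h1 i i.2
    ext x
    rw [Finset.mem_coe]
    constructor
    · rintro ⟨e, he, rfl⟩
      rw [inc_cases] at he
      rcases he with rfl | rfl | ⟨k, rfl⟩
      · rw [c1 i (by omega)]; exact h5
      · rw [c1 (i + 1) (by omega)]; exact h6
      · rw [c2]; exact ((hgm i _).1 ⟨k, rfl⟩).1
    · intro hx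
      by_cases hx1 : x = a i
      · exact ⟨_, (inc_cases ℓ d i _).2 (Or.inl rfl), by rw [c1 i (by omega), hx1]⟩
      · by_cases hx2 : x = a (i + 1)
        · exact ⟨_, (inc_cases ℓ d i _).2 (Or.inr (Or.inl rfl)),
            by rw [c1 (i + 1) (by omega), hx2]⟩
        · obtain ⟨k, hk⟩ := (hgm i x).2 ⟨hx, hx1, hx2⟩
          exact ⟨_, (inc_cases ℓ d i _).2 (Or.inr (Or.inr ⟨k, rfl⟩)), by rw [c2, hk]⟩
  have inj : ∀ i : Fin ℓ, ∀ e ∈ Einc (Cat ℓ d) (Sum.inl ⟨i + 1, by omega⟩),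
      ∀ f ∈ Einc (Cat ℓ d) (Sum.inl ⟨i + 1, by omega⟩), φ e = φ f → e = f := by
    intro i e he f hf h
    obtain ⟨_, h4, h5, h6, h7⟩ := h1 i i.2
    rw [inc_cases] at he hf
    rcases he with rfl | rfl | ⟨k, rfl⟩ <;> rcases hf with rfl | rfl | ⟨k', rfl⟩
    · rfl
    · rw [c1 i (by omega), c1 (i + 1) (by omega)] at h; exact absurd h h7
    · rw [c1 i (by omega), c2] at h; exact absurd h.symm ((hgm i _).1 ⟨k', rfl⟩).2.1
    · rw [c1 i (by omega), c1 (i + 1) (by omega)] at h; exact absurd h.symm h7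
    · rfl
    · rw [c1 (i + 1) (by omega), c2] at h; exact absurd h.symm ((hgm i _).1 ⟨k', rfl⟩).2.2
    · rw [c1 i (by omega), c2] at h; exact absurd h ((hgm i _).1 ⟨k, rfl⟩).2.1
    · rw [c1 (i + 1) (by omega), c2] at h; exact absurd h ((hgm i _).1 ⟨k, rfl⟩).2.2
    · rw [c2, c2] at h
      rw [hgi i h]
  have mem : ∀ i (hi : i < ℓ), ∀ e ∈ Einc (Cat ℓ d) (Sum.inl ⟨i + 1, by omega⟩), φ e ∈ S i := by
    intro i hi e he
    have : φ e ∈ φ '' Einc (Cat ℓ d) (Sum.inl ⟨i + 1, by omega⟩) := ⟨e, he, rfl⟩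
    rw [im ⟨i, hi⟩] at this
    exact this
  have step : ∀ i (hi : i + 1 < ℓ), ∀ e ∈ Einc (Cat ℓ d) (Sum.inl ⟨i + 1, by omega⟩),
      ∀ f ∈ Einc (Cat ℓ d) (Sum.inl ⟨i + 1 + 1, by omega⟩), φ e = φ f → e = f := by
    intro i hi e he f hf h
    have m1 := mem i (by omega) e he
    have m2 := mem (i + 1) hi f hf
    have m3 : φ e ∈ S i ∩ S (i + 1) := Finset.mem_inter.2 ⟨m1, h ▸ m2⟩
    rw [h2 i hi, Finset.mem_singleton] at m3
    have q1 := inj ⟨i, by omega⟩ e he s(Sum.inl ⟨i + 1, by omega⟩, Sum.inl ⟨i + 1 + 1, by omega⟩)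
      ((inc_cases ℓ d ⟨i, by omega⟩ _).2 (Or.inr (Or.inl rfl))) (by rw [m3, c1 (i + 1) (by omega)])
    have q2 := inj ⟨i + 1, by omega⟩ f hf
      s(Sum.inl ⟨i + 1, by omega⟩, Sum.inl ⟨i + 1 + 1, by omega⟩)
      ((inc_cases ℓ d ⟨i + 1, by omega⟩ _).2 (Or.inl rfl)) (by rw [← h, m3, c1 (i + 1) (by omega)])
    rw [q1, q2]
  refine ⟨φ, ?_, ?_, ?_, ?_, ?_, ?_⟩
  · intro e he
    obtain ⟨u, hu⟩ : ∃ u, u ∈ e := by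
      induction e using Sym2.ind with
      | _ x y => exact ⟨x, by simp⟩
    have := mem _ (cen_lt ℓ d (by omega) u) e (cen_inc ℓ d hl u e he hu)
    exact (h1 _ (cen_lt ℓ d (by omega) u)).1 this
  · rintro e he f hf hne ⟨u, v, hu, hv, huv⟩ hφ
    obtain ⟨i, l1, hi, e1⟩ : ∃ (i : ℕ) (l : i < ℓ), cen ℓ d u = i ∧
        e ∈ Einc (Cat ℓ d) (Sum.inl ⟨i + 1, by omega⟩) :=
      ⟨_, cen_lt ℓ d (by omega) u, rfl, cen_inc ℓ d hl u e he hu⟩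
    obtain ⟨j, l2, hj, f1⟩ : ∃ (i : ℕ) (l : i < ℓ), cen ℓ d v = i ∧
        f ∈ Einc (Cat ℓ d) (Sum.inl ⟨i + 1, by omega⟩) :=
      ⟨_, cen_lt ℓ d (by omega) v, rfl, cen_inc ℓ d hl v f hf hv⟩
    have hc : cen ℓ d u = cen ℓ d v ∨ cen ℓ d v = cen ℓ d u + 1 ∨ cen ℓ d u = cen ℓ d v + 1 := by
      rcases huv with rfl | h
      · exact Or.inl rfl
      · exact cen_adj ℓ d u v h
    apply hne
    rw [hi, hj] at hc
    clear hi hj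
    rcases hc with rfl | rfl | rfl
    · exact inj ⟨i, l1⟩ e e1 f f1 hφ
    · exact step i l2 e e1 f f1 hφ
    · exact (step j l1 f f1 e e1 hφ.symm).symm
  · exact im ⟨0, by omega⟩
  · have := im ⟨ℓ - 1, by omega⟩
    have e : ℓ - 1 + 1 = ℓ := by omega
    simp only [e] at this
    exact this
  · exact c1 0 (by omega)
  · exact c1 ℓ (by omega)

theorem twoSided_of_nice (ℓ : ℕ) (d : ℕ → ℕ)
    (hd : ∀ i, 1 ≤ i → i ≤ ℓ → 2 ≤ d i)
    (h5 : 5 ≤ sigmaG (Cat ℓ d))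
    (hl : sigmaG (Cat ℓ d) + 3 ≤ ℓ)
    (hΔ : maxDeg (Cat ℓ d) + 2 ≤ sigmaG (Cat ℓ d))
    (κ : ℕ) (hκ : sigmaG (Cat ℓ d) ≤ κ) :
    TwoSidedPrecolorable ℓ d κ := by
  intro C C₁ Cl hC h1 hl1 hc1 hcl α₀ hα αl hαl
  have hok := cat_okd ℓ d hd (by omega) hΔ
  have hsol := good_big _ (ℓ - 1) (by omega) (good_all good_base _ h5 (ℓ - 1) (by omega)) κ hκ
    (fun i => d (i + 1)) C C₁ α₀ Cl αl hok hC h1 hl1 hc1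
    (by rw [hcl]; congr 1; omega) hα hαl
  obtain ⟨S, a, rfl, rfl, rfl, rfl, g5, g6⟩ := Sol.seq _ _ _ _ _ _ _ hsol h1 hc1 hα hαl
  have key := cat_of_seq ℓ d (by omega) hd C S a (fun i hi => g5 i (by omega))
    (fun i hi => g6 i (by omega))
  have e : ℓ - 1 + 1 = ℓ := by omega
  rw [e]
  exact key
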